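/- arXiv:2106.04417 — 2 statements merged into one kernel-verified Lean document; each statement's English description precedes it below -/
import Mathlib

section
/- Let T and T' be finite trees. If the chromatic symmetric functions of T and T' are equal, i.e. X_T = X_{T'}, then their bivariate subtree polynomials are equal, i.e. S_T(q,r) = S_{T'}(q,r). -/
open scoped Classical

noncomputable section

variable {V : Type*}

/-- A coloring `κ : V → ℕ` is proper if adjacent vertices get distinct colors. -/
def Proper (G : SimpleGraph V) (κ : V → ℕ) : Prop :=
  ∀ ⦃u v : V⦄, G.Adj u v → κ u ≠ κ v

/-- The chromatic symmetric function of `G`, as a formal power series in the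
variables `x_0, x_1, x_2, …`: the coefficient of the monomial `∏ i, x_i ^ m i`
is the number of proper colorings `κ : V → ℕ` using color `i` exactly `m i` times. -/
def csf [Fintype V] (G : SimpleGraph V) : MvPowerSeries ℕ ℤ :=
  fun m => (Nat.card {κ : V → ℕ // Proper G κ ∧ ∀ i : ℕ, Nat.card {v : V // κ v = i} = m i} : ℤ)

/-- `A` is (the vertex set of) a subtree of `T`: the induced subgraph on `A` is
connected and has at least one edge. -/
def IsSubtree [Fintype V] (T : SimpleGraph V) (A : Finset V) : Prop :=
  (T.induce (A : Set V)).Connected ∧ ∃ u ∈ A, ∃ v ∈ A, T.Adj u v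

/-- The number of edges of the subgraph of `T` induced on `A`. -/
def edgeCount [Fintype V] (T : SimpleGraph V) (A : Finset V) : ℕ :=
  Nat.card (T.induce (A : Set V)).edgeSet

/-- The number of leaves (vertices of degree 1) of the subgraph of `T` induced on `A`. -/
def leafCount [Fintype V] (T : SimpleGraph V) (A : Finset V) : ℕ :=
  Nat.card {v : (A : Set V) // Nat.card ((T.induce (A : Set V)).neighborSet v) = 1}

/-- The bivariate subtree polynomial `S_T(q, r) = ∑_{subtrees S of T} q^{|E(S)|} r^{|L(S)|}`,
with `q = X 0` and `r = X 1`. -/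
def subtreePoly [Fintype V] (T : SimpleGraph V) : MvPolynomial (Fin 2) ℤ :=
  ∑ A ∈ Finset.univ.powerset.filter (fun A => IsSubtree T A),
    MvPolynomial.X 0 ^ edgeCount T A * MvPolynomial.X 1 ^ leafCount T A

/-- The degree sequence of `T`, as a multiset. -/
def degreeSequence [Fintype V] (T : SimpleGraph V) : Multiset ℕ :=
  Finset.univ.val.map (fun v => T.degree v)

/-- The set of leaves (vertices of degree 1) of `T`. -/
def leaves [Fintype V] (T : SimpleGraph V) : Finset V :=
  Finset.univ.filter (fun v => T.degree v = 1)

/-- `A` is (the vertex set of) the trunk of `T`: the smallest connected induced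
subgraph of `T` containing every vertex of degree at least 3. -/
def IsTrunk [Fintype V] (T : SimpleGraph V) (A : Finset V) : Prop :=
  (T.induce (A : Set V)).Connected ∧ (∀ v : V, 3 ≤ T.degree v → v ∈ A) ∧
    ∀ B : Finset V, (T.induce (B : Set V)).Connected → (∀ v : V, 3 ≤ T.degree v → v ∈ B) →
      A ⊆ B

/-- Every interior (non-endpoint) vertex of the walk `P` has degree 2 in `T`. -/
def InteriorDeg2 [Fintype V] (T : SimpleGraph V) {a b : V} (P : T.Walk a b) : Prop :=
  ∀ v ∈ P.support, v ≠ a → v ≠ b → T.degree v = 2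

/-- `P` is the twig of `l`: the longest path in `T` containing `l` all of whose
interior vertices have degree 2 in `T`. -/
def IsTwig [Fintype V] (T : SimpleGraph V) (l : V) {a b : V} (P : T.Walk a b) : Prop :=
  P.IsPath ∧ l ∈ P.support ∧ InteriorDeg2 T P ∧
    ∀ ⦃a' b' : V⦄ (Q : T.Walk a' b'), Q.IsPath → l ∈ Q.support → InteriorDeg2 T Q →
      Q.length ≤ P.length

/-- The length (number of edges) of the twig of `l`: the maximal length of a path
in `T` containing `l` all of whose interior vertices have degree 2 in `T`. -/
def twigLen [Fintype V] (T : SimpleGraph V) (l : V) : ℕ :=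
  sSup {n : ℕ | ∃ (a b : V) (P : T.Walk a b),
    P.IsPath ∧ l ∈ P.support ∧ InteriorDeg2 T P ∧ P.length = n}

/-- The multiset of lengths of the twigs of `T` (one twig for each leaf). -/
def twigLengths [Fintype V] (T : SimpleGraph V) : Multiset ℕ :=
  (leaves T).val.map (twigLen T)

end

open Finset

/-- The number of neighbours of `v` in the vertex set `U`. -/
noncomputable def degIn {V : Type*} (T : SimpleGraph V) (v : V) (U : Finset V) : ℕ :=
  #{w ∈ U | T.Adj v w}

/-- The number of ordered pairs `(u, w) ∈ U × W` of adjacent vertices. -/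
noncomputable def crossCount {V : Type*} (T : SimpleGraph V) (U W : Finset V) : ℕ :=
  ∑ u ∈ U, degIn T u W

/-- Half the number of ordered pairs of adjacent vertices in `U`, which is the number of edges
of the induced subgraph on `U`. -/
noncomputable def inducedEdges {V : Type*} (T : SimpleGraph V) (U : Finset V) : ℕ :=
  crossCount T U U / 2

section Counting

variable {V : Type*} {T : SimpleGraph V}

lemma crossCount_comm (U W : Finset V) : crossCount T U W = crossCount T W U := by
  have := sum_card_bipartiteAbove_eq_sum_card_bipartiteBelow (s := U) (t := W) T.Adj
  simpa only [crossCount, degIn, bipartiteAbove, bipartiteBelow, T.adj_comm] using this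

lemma degIn_union {U W : Finset V} (h : Disjoint U W) (v : V) :
    degIn T v (U ∪ W) = degIn T v U + degIn T v W := by
  rw [degIn, filter_union, card_union_of_disjoint (disjoint_filter_filter h)]
  rfl

lemma degIn_mono {U W : Finset V} (h : U ⊆ W) (v : V) : degIn T v U ≤ degIn T v W :=
  card_le_card (filter_subset_filter _ h)

lemma crossCount_union_left {U W : Finset V} (h : Disjoint U W) (X : Finset V) :
    crossCount T (U ∪ W) X = crossCount T U X + crossCount T W X :=
  sum_union h

lemma crossCount_union_right {U W : Finset V} (h : Disjoint U W) (X : Finset V) :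
    crossCount T X (U ∪ W) = crossCount T X U + crossCount T X W := by
  simp only [crossCount, degIn_union h, sum_add_distrib]

lemma crossCount_union_self {U W : Finset V} (h : Disjoint U W) :
    crossCount T (U ∪ W) (U ∪ W) = crossCount T U U + 2 * crossCount T U W + crossCount T W W := by
  rw [crossCount_union_left h, crossCount_union_right h, crossCount_union_right h,
    crossCount_comm W U]
  ring

lemma crossCount_insert_self {v : V} {U : Finset V} (h : v ∉ U) :
    crossCount T (insert v U) (insert v U) = crossCount T U U + 2 * degIn T v U := by
  have hd : Disjoint {v} U := by simpa using h
  rw [insert_eq, crossCount_union_self hd]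
  simp [crossCount, degIn, filter_singleton]
  ring

lemma inducedEdges_insert {v : V} {U : Finset V} (h : v ∉ U) :
    inducedEdges T (insert v U) = inducedEdges T U + degIn T v U := by
  rw [inducedEdges, crossCount_insert_self h, inducedEdges]
  omega

@[simp] lemma inducedEdges_empty : inducedEdges T ∅ = 0 := by
  simp [inducedEdges, crossCount]

lemma crossCount_self (U : Finset V) : crossCount T U U = 2 * inducedEdges T U := by
  induction U using Finset.induction with
  | empty => simp [crossCount]
  | insert v U hv ih => rw [crossCount_insert_self hv, inducedEdges_insert hv, ih]; ring

lemma inducedEdges_union {U W : Finset V} (h : Disjoint U W) :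
    inducedEdges T (U ∪ W) = inducedEdges T U + crossCount T U W + inducedEdges T W := by
  have := crossCount_union_self (T := T) h
  simp only [crossCount_self] at this
  omega

lemma card_neighborSet_induce {U : Finset V} (v : (U : Set V)) :
    Nat.card ((T.induce (U : Set V)).neighborSet v) = degIn T v U := by
  rw [degIn, ← Nat.card_eq_finsetCard]
  exact Nat.card_congr ⟨fun w => ⟨w.1.1, mem_filter.2 ⟨w.1.2, w.2⟩⟩,
    fun w => ⟨⟨w.1, (mem_filter.1 w.2).1⟩, (mem_filter.1 w.2).2⟩, fun w => rfl, fun w => rfl⟩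

lemma edgeCount_eq [Fintype V] (U : Finset V) : edgeCount T U = inducedEdges T U := by
  have h := (T.induce (U : Set V)).sum_degrees_eq_twice_card_edges
  have h2 : ∀ v : (U : Set V), (T.induce (U : Set V)).degree v = degIn T v U := fun v => by
    rw [← card_neighborSet_induce, ← SimpleGraph.card_neighborSet_eq_degree,
      Nat.card_eq_fintype_card]
  simp only [h2] at h
  have h3 : ∑ v : (U : Set V), degIn T v U = crossCount T U U :=
    sum_coe_sort U (fun v => degIn T v U)
  rw [h3, crossCount_self] at h
  rw [edgeCount, Nat.card_eq_fintype_card, ← SimpleGraph.edgeFinset_card]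
  omega

lemma leafCount_eq [Fintype V] (U : Finset V) : leafCount T U = #{v ∈ U | degIn T v U = 1} := by
  rw [leafCount, ← Nat.card_eq_finsetCard]
  simp only [card_neighborSet_induce]
  exact Nat.card_congr ⟨fun w => ⟨w.1.1, mem_filter.2 ⟨w.1.2, w.2⟩⟩,
    fun w => ⟨⟨w.1, (mem_filter.1 w.2).1⟩, (mem_filter.1 w.2).2⟩, fun w => rfl, fun w => rfl⟩

end Counting

section Forest

variable {V : Type*} {T : SimpleGraph V}

lemma exists_degIn_le_one (hT : T.IsTree) {U : Finset V} (hU : U.Nonempty) :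
    ∃ v ∈ U, degIn T v U ≤ 1 := by
  obtain ⟨r, -⟩ := id hU
  obtain ⟨v, hv, hmax⟩ := U.exists_max_image (T.dist r) hU
  refine ⟨v, hv, ?_⟩
  obtain ⟨p, hp, hpl⟩ := hT.1.exists_path_of_dist r v
  have key : ∀ w ∈ U, T.Adj v w → w = p.penultimate := by
    intro w hw hvw
    refine hT.2.eq_penultimate_of_adj_end hp hvw ?_
    by_contra hns
    obtain ⟨q, hq, hql⟩ := hT.1.exists_path_of_dist r w
    have h1 := hp.concat hns hvw
    have h2 : q = p.concat hvw :=
      Subtype.mk.inj (hT.2.subsingleton_path r w |>.elim ⟨q, hq⟩ ⟨_, h1⟩)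
    have h3 := hmax w hw
    rw [← hpl, ← hql, h2, SimpleGraph.Walk.length_concat] at h3
    omega
  rw [degIn, card_le_one]
  intro a ha b hb
  rw [mem_filter] at ha hb
  rw [key a ha.1 ha.2, key b hb.1 hb.2]

/-- Every finite vertex set of a tree can be built by successively adding vertices that are
adjacent to at most one of the vertices already present. -/
lemma forest_induction (hT : T.IsTree) {P : Finset V → Prop} (empty : P ∅)
    (insert : ∀ v U, v ∉ U → degIn T v U ≤ 1 → P U → P (insert v U)) (U : Finset V) : P U := by
  induction h : #U generalizing U with
  | zero => rw [card_eq_zero] at h; exact h ▸ empty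
  | succ n ih =>
    obtain ⟨v, hv, hd⟩ := exists_degIn_le_one hT (card_pos.1 (by omega : 0 < #U))
    rw [← insert_erase hv]
    exact insert v _ (notMem_erase v U) ((degIn_mono (erase_subset v U) v).trans hd)
      (ih _ (by rw [card_erase_of_mem hv]; omega))

lemma inducedEdges_lt_card (hT : T.IsTree) {U : Finset V} (hU : U.Nonempty) :
    inducedEdges T U + 1 ≤ #U := by
  induction U using forest_induction hT with
  | empty => simp at hU
  | insert v U hv hd ih =>
    rw [inducedEdges_insert hv, card_insert_of_notMem hv]
    rcases U.eq_empty_or_nonempty with rfl | hU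
    · simp [degIn]
    · have := ih hU
      omega

lemma inducedEdges_le_card (hT : T.IsTree) (U : Finset V) : inducedEdges T U ≤ #U := by
  rcases U.eq_empty_or_nonempty with rfl | hU
  · simp
  · exact (Nat.le_succ _).trans (inducedEdges_lt_card hT hU)

lemma inducedEdges_of_connected [Fintype V] (hT : T.IsTree) {U : Finset V}
    (hU : (T.induce (U : Set V)).Connected) : inducedEdges T U + 1 = #U := by
  have h : (T.induce (U : Set V)).IsTree := ⟨hU, hT.2.induce _⟩
  rw [← edgeCount_eq, edgeCount, (SimpleGraph.isTree_iff_connected_and_card.1 h).2]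
  exact Nat.card_eq_finsetCard U

lemma connected_of_inducedEdges (hT : T.IsTree) {U : Finset V}
    (hU : inducedEdges T U + 1 = #U) : (T.induce (U : Set V)).Connected := by
  induction U using forest_induction hT with
  | empty => simp at hU
  | insert v U hv hd ih =>
    rw [inducedEdges_insert hv, card_insert_of_notMem hv] at hU
    rcases U.eq_empty_or_nonempty with rfl | hne
    · rw [insert_empty_eq, coe_singleton]
      exact SimpleGraph.IsTree.of_subsingleton.1
    · have := inducedEdges_lt_card hT hne
      have hd1 : degIn T v U = 1 := by omega
      obtain ⟨w, hw⟩ := card_pos.1 (by rw [← degIn, hd1]; exact one_pos)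
      rw [mem_filter] at hw
      have h1 := ih (by omega)
      have h2 := SimpleGraph.induce_pair_connected_of_adj hw.2
      have h3 := SimpleGraph.induce_union_connected h2.preconnected h1.preconnected
        ⟨w, by simp, hw.1⟩
      have h4 : ((insert v U : Finset V) : Set V) = {v, w} ∪ (U : Set V) := by
        rw [coe_insert, Set.insert_union, Set.singleton_union,
          Set.insert_eq_of_mem (mem_coe.2 hw.1)]
      rwa [h4]

lemma connected_iff_inducedEdges [Fintype V] (hT : T.IsTree) {U : Finset V} :
    (T.induce (U : Set V)).Connected ↔ inducedEdges T U + 1 = #U :=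
  ⟨inducedEdges_of_connected hT, connected_of_inducedEdges hT⟩

end Forest

section Coloring

variable {V : Type*} {T : SimpleGraph V}

/-- The value at `c` of the chromatic polynomial of the forest induced on `U`. -/
noncomputable def forestChrom {R : Type*} [CommRing R] (T : SimpleGraph V) (U : Finset V) (c : R) :
    R :=
  c ^ (#U - inducedEdges T U) * (c - 1) ^ inducedEdges T U

lemma forestChrom_insert {R : Type*} [CommRing R] (hT : T.IsTree) {v : V} {U : Finset V}
    (hv : v ∉ U) (hd : degIn T v U ≤ 1) (c : R) :
    forestChrom T (insert v U) c = forestChrom T U c * (c - degIn T v U) := by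
  rw [forestChrom, forestChrom, inducedEdges_insert hv, card_insert_of_notMem hv]
  have := inducedEdges_le_card hT U
  interval_cases h : degIn T v U
  · rw [add_zero, Nat.sub_add_comm this, pow_succ]
    push_cast
    ring
  · rw [Nat.add_sub_add_right, pow_succ]
    push_cast
    ring

/-- The colorings of `W`, extended by `0`, that are proper on `W` and assign to every `v ∈ W`
a color from the list `L v`. -/
noncomputable def listColorings [Fintype V] (T : SimpleGraph V) (L : V → Finset ℕ)
    (W : Finset V) : Finset (V → ℕ) :=
  {κ ∈ Fintype.piFinset fun v => if v ∈ W then L v else {0} |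
    ∀ u ∈ W, ∀ w ∈ W, T.Adj u w → κ u ≠ κ w}

lemma mem_listColorings [Fintype V] {L : V → Finset ℕ} {W : Finset V} {κ : V → ℕ} :
    κ ∈ listColorings T L W ↔ (∀ v ∈ W, κ v ∈ L v) ∧ (∀ v ∉ W, κ v = 0) ∧
      ∀ u ∈ W, ∀ w ∈ W, T.Adj u w → κ u ≠ κ w := by
  rw [listColorings, mem_filter, Fintype.mem_piFinset, ← and_assoc]
  refine and_congr_left fun _ => ⟨fun h => ⟨fun v hv => ?_, fun v hv => ?_⟩, fun h v => ?_⟩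
  · simpa [hv] using h v
  · simpa [hv] using h v
  · split_ifs with hv
    · exact h.1 v hv
    · simpa using h.2 v hv

lemma card_listColorings_insert [Fintype V] {L : V → Finset ℕ} {v : V} {W : Finset V}
    (hv : v ∉ W) :
    #(listColorings T L (insert v W)) =
      ∑ κ ∈ listColorings T L W, #{x ∈ L v | ∀ w ∈ W, T.Adj v w → x ≠ κ w} := by
  rw [← card_sigma]
  refine card_bij' (fun κ _ => ⟨Function.update κ v 0, κ v⟩)
    (fun p _ => Function.update p.1 v p.2) ?_ ?_ ?_ ?_
  · intro κ hκ
    rw [mem_listColorings] at hκ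
    obtain ⟨h1, h2, h3⟩ := hκ
    rw [mem_sigma, mem_listColorings, mem_filter]
    have hne : ∀ w ∈ W, Function.update κ v 0 w = κ w := fun w hw =>
      Function.update_of_ne (ne_of_mem_of_not_mem hw hv) _ _
    refine ⟨⟨fun w hw => ?_, fun w hw => ?_, fun u hu w hw huw => ?_⟩,
      h1 v (mem_insert_self _ _), fun w hw hvw => ?_⟩
    · dsimp only
      rw [hne w hw]
      exact h1 w (mem_insert_of_mem hw)
    · by_cases hwv : w = v
      · subst hwv
        simp
      · dsimp only
        rw [Function.update_of_ne hwv]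
        exact h2 w (by simp [hwv, hw])
    · dsimp only
      rw [hne u hu, hne w hw]
      exact h3 u (mem_insert_of_mem hu) w (mem_insert_of_mem hw) huw
    · dsimp only
      rw [hne w hw]
      exact h3 v (mem_insert_self _ _) w (mem_insert_of_mem hw) hvw
  · rintro ⟨κ, x⟩ hp
    rw [mem_sigma, mem_listColorings, mem_filter] at hp
    obtain ⟨⟨h1, h2, h3⟩, h4, h5⟩ := hp
    dsimp only at h1 h2 h3 h4 h5 ⊢
    have hne : ∀ w ∈ W, Function.update κ v x w = κ w := fun w hw =>
      Function.update_of_ne (ne_of_mem_of_not_mem hw hv) _ _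
    rw [mem_listColorings]
    refine ⟨(forall_mem_insert _ _ _).2 ⟨by simpa using h4, fun w hw => ?_⟩, fun w hw => ?_,
      (forall_mem_insert _ _ _).2 ⟨(forall_mem_insert _ _ _).2 ⟨?_, fun w hw h => ?_⟩,
        fun u hu => (forall_mem_insert _ _ _).2 ⟨fun h => ?_, fun w hw h => ?_⟩⟩⟩
    · rw [hne w hw]
      exact h1 w hw
    · rw [mem_insert, not_or] at hw
      rw [Function.update_of_ne hw.1]
      exact h2 w hw.2
    · exact fun h => (T.loopless.irrefl v h).elim
    · rw [hne w hw, Function.update_self]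
      exact h5 w hw h
    · rw [hne u hu, Function.update_self]
      exact (h5 u hu h.symm).symm
    · rw [hne u hu, hne w hw]
      exact h3 u hu w hw h
  · intro κ _
    simp
  · rintro ⟨κ, x⟩ hp
    rw [mem_sigma, mem_listColorings] at hp
    have : κ v = 0 := hp.1.2.1 v hv
    simp [← this]

lemma card_available_colors [Fintype V] {L : V → Finset ℕ} {U : Finset V} {A B : Finset ℕ}
    (hAB : Disjoint A B) (hA : ∀ v ∈ U, L v = A) (hB : ∀ v ∉ U, L v = B) {v : V} {W : Finset V}
    (hd : degIn T v W ≤ 1) {κ : V → ℕ} (hκ : ∀ w ∈ W, κ w ∈ L w) :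
    (#{x ∈ L v | ∀ w ∈ W, T.Adj v w → x ≠ κ w} : ℤ) =
      #(L v) - degIn T v {w ∈ W | w ∈ U ↔ v ∈ U} := by
  rcases Nat.le_one_iff_eq_zero_or_eq_one.1 hd with h | h
  · have h0 := degIn_mono (T := T) (filter_subset (fun w => w ∈ U ↔ v ∈ U) W) v
    rw [h, Nat.le_zero] at h0
    rw [h0, filter_true_of_mem]
    · simp
    · intro x _ w hw hvw
      rw [degIn, card_eq_zero, filter_eq_empty_iff] at h
      exact (h hw hvw).elim
  · rw [degIn, card_eq_one] at h
    obtain ⟨w, hw⟩ := h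
    have hmem : ∀ u, (u ∈ W ∧ T.Adj v u) ↔ u = w := fun u => by
      rw [← mem_filter, hw, mem_singleton]
    have hwW := (hmem w).2 rfl
    have h1 : {x ∈ L v | ∀ w ∈ W, T.Adj v w → x ≠ κ w} = (L v).erase (κ w) := by
      ext x
      rw [mem_filter, mem_erase, and_comm]
      refine and_congr_left fun _ => ⟨fun h => h w hwW.1 hwW.2, fun h u hu hvu => ?_⟩
      rwa [(hmem u).1 ⟨hu, hvu⟩]
    have h2 : degIn T v {w ∈ W | w ∈ U ↔ v ∈ U} = if w ∈ U ↔ v ∈ U then 1 else 0 := by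
      rw [degIn, filter_comm, hw, filter_singleton]
      split_ifs <;> simp
    rw [h1, h2]
    have hκw := hκ w hwW.1
    split_ifs with h3
    · have h4 : L w = L v := by
        by_cases h5 : w ∈ U
        · rw [hA w h5, hA v (h3.1 h5)]
        · rw [hB w h5, hB v (fun h => h5 (h3.2 h))]
      rw [h4] at hκw
      rw [card_erase_of_mem hκw, Nat.cast_sub (card_pos.2 ⟨_, hκw⟩)]
    · rw [erase_eq_of_notMem]
      · simp
      · intro h5
        by_cases h6 : w ∈ U
        · rw [hA w h6] at hκw
          rw [hB v (by tauto)] at h5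
          exact disjoint_left.1 hAB hκw h5
        · rw [hB w h6] at hκw
          rw [hA v (by tauto)] at h5
          exact disjoint_left.1 hAB h5 hκw

lemma card_listColorings [Fintype V] (hT : T.IsTree) {L : V → Finset ℕ} {U : Finset V}
    {A B : Finset ℕ} (hAB : Disjoint A B) (hA : ∀ v ∈ U, L v = A) (hB : ∀ v ∉ U, L v = B)
    (W : Finset V) :
    (#(listColorings T L W) : ℤ) =
      forestChrom T {w ∈ W | w ∈ U} (#A : ℤ) * forestChrom T {w ∈ W | w ∉ U} (#B : ℤ) := by
  induction W using forest_induction hT with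
  | empty =>
    have : listColorings T L ∅ = {fun _ => 0} := by
      ext κ
      rw [mem_listColorings]
      simp [funext_iff]
    simp [this, forestChrom]
  | insert v W hv hd ih =>
    rw [card_listColorings_insert hv, Nat.cast_sum, sum_congr rfl fun κ hκ =>
      card_available_colors hAB hA hB hd (mem_listColorings.1 hκ).1, sum_const, nsmul_eq_mul, ih,
      filter_insert, filter_insert]
    by_cases h : v ∈ U
    · simp only [h, iff_true, if_true, not_true, if_false, hA v h]
      rw [forestChrom_insert hT (by simp [hv])
        ((degIn_mono (filter_subset _ _) v).trans hd)]
      ring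
    · simp only [h, iff_false, if_true, not_false_eq_true, if_false, hB v h]
      rw [forestChrom_insert hT (by simp [hv])
        ((degIn_mono (filter_subset _ _) v).trans hd)]
      ring

end Coloring

section ColorCount

variable {V V' : Type*} {T' : SimpleGraph V'} {T : SimpleGraph V}

/-- The number of proper colorings with the colors `0, …, t + c - 1` in which exactly `k` vertices
receive one of the last `c` colors. -/
noncomputable def colorCount [Fintype V] (T : SimpleGraph V) (t c k : ℕ) : ℕ :=
  Nat.card {κ : {κ : V → ℕ // Proper T κ} // (∀ v, κ.1 v < t + c) ∧ #{v | t ≤ κ.1 v} = k}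

lemma colorCount_eq [Fintype V] (hT : T.IsTree) (t c k : ℕ) :
    (colorCount T t c k : ℤ) =
      ∑ U ∈ powersetCard k univ, forestChrom T U (c : ℤ) * forestChrom T Uᶜ (t : ℤ) := by
  set S : Finset (V → ℕ) :=
    {κ ∈ Fintype.piFinset fun _ => range (t + c) | Proper T κ ∧ #{v | t ≤ κ v} = k}
  have hS : colorCount T t c k = #S := by
    rw [colorCount, ← Nat.card_eq_finsetCard,
      Nat.card_congr (Equiv.subtypeSubtypeEquivSubtypeInter (Proper T)
        fun κ => (∀ v, κ v < t + c) ∧ #{v | t ≤ κ v} = k)]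
    refine Nat.card_congr (Equiv.subtypeEquivRight fun κ => ?_)
    simp only [S, mem_filter, Fintype.mem_piFinset, mem_range]
    tauto
  rw [hS, card_eq_sum_card_fiberwise (f := fun κ : V → ℕ => ({v | t ≤ κ v} : Finset V))
    (t := powersetCard k univ)
    (fun κ hκ => mem_powersetCard_univ.2 (mem_filter.1 (mem_coe.1 hκ)).2.2), Nat.cast_sum]
  refine sum_congr rfl fun U hU => ?_
  rw [mem_powersetCard_univ] at hU
  have hfib : {κ ∈ S | ({v | t ≤ κ v} : Finset V) = U} =
      listColorings T (fun v => if v ∈ U then Ico t (t + c) else range t) univ := by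
    ext κ
    simp only [S, mem_filter, Fintype.mem_piFinset, mem_range, mem_listColorings, mem_univ,
      not_true, false_imp_iff, implies_true, true_and, forall_const]
    constructor
    · rintro ⟨⟨h1, h2, -⟩, rfl⟩
      refine ⟨fun v => ?_, fun u w h => h2 h⟩
      have := h1 v
      simp only [mem_filter_univ]
      split_ifs with h
      · exact mem_Ico.2 ⟨h, this⟩
      · exact mem_range.2 (not_le.1 h)
    · rintro ⟨h1, h2⟩
      have h3 : ({v | t ≤ κ v} : Finset V) = U := by
        ext v
        have := h1 v
        rw [mem_filter_univ]
        split_ifs at this with h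
        · exact iff_of_true (mem_Ico.1 this).1 h
        · exact iff_of_false (not_le.2 (mem_range.1 this)) h
      refine ⟨⟨fun v => ?_, fun u w h => h2 u w h, by rw [h3, hU]⟩, h3⟩
      have := h1 v
      split_ifs at this with h
      · exact (mem_Ico.1 this).2
      · exact (mem_range.1 this).trans_le (Nat.le_add_right _ _)
  rw [hfib, card_listColorings hT (U := U) (A := Ico t (t + c)) (B := range t)
    (disjoint_left.2 fun x hx hx' => (mem_Ico.1 hx).1.not_gt (mem_range.1 hx'))
    (fun v hv => if_pos hv) (fun v hv => if_neg hv)]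
  congr 2
  · simp
  · simp
  · ext v
    simp
  · simp

/-- The number of vertices of each color, as a finitely supported function. -/
noncomputable def colorProfile [Fintype V] (κ : V → ℕ) : ℕ →₀ ℕ :=
  (univ.val.map κ).toFinsupp

lemma colorProfile_apply [Fintype V] (κ : V → ℕ) (i : ℕ) :
    colorProfile κ i = Nat.card {v // κ v = i} := by
  rw [colorProfile, Multiset.toFinsupp_apply, Multiset.count_map, Nat.card_eq_fintype_card,
    Fintype.card_subtype]
  simp only [eq_comm (a := i)]
  rfl

lemma csf_apply [Fintype V] (m : ℕ →₀ ℕ) :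
    csf T m = Nat.card {κ : {κ : V → ℕ // Proper T κ} // colorProfile κ.1 = m} := by
  rw [csf, Nat.cast_inj, Nat.card_congr (Equiv.subtypeSubtypeEquivSubtypeInter (Proper T)
    fun κ => colorProfile κ = m)]
  simp only [Finsupp.ext_iff, colorProfile_apply]

lemma finite_colorProfile_fiber [Fintype V] (m : ℕ →₀ ℕ) :
    Finite {κ : {κ : V → ℕ // Proper T κ} // colorProfile κ.1 = m} := by
  have h : (Set.pi Set.univ fun _ : V => (m.support : Set ℕ)).Finite :=
    Set.Finite.pi fun _ => m.support.finite_toSet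
  have := h.to_subtype
  refine Finite.of_injective (β := Set.pi Set.univ fun _ : V => (m.support : Set ℕ))
    (fun κ => ⟨κ.1.1, fun v _ => ?_⟩) fun κ κ' hκ => ?_
  · rw [mem_coe, Finsupp.mem_support_iff, ← DFunLike.congr_fun κ.2, colorProfile_apply]
    have : Nonempty {w // κ.1.1 w = κ.1.1 v} := ⟨⟨v, rfl⟩⟩
    exact Nat.card_pos.ne'
  · exact Subtype.ext (Subtype.ext (Subtype.mk.inj hκ))

lemma exists_equiv_of_csf_eq [Fintype V] [Fintype V'] (h : csf T = csf T') :
    ∃ Φ : {κ : V → ℕ // Proper T κ} ≃ {κ : V' → ℕ // Proper T' κ},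
      ∀ κ, univ.val.map (Φ κ).1 = univ.val.map κ.1 := by
  have e : ∀ m : ℕ →₀ ℕ, Nonempty ({κ : {κ : V → ℕ // Proper T κ} // colorProfile κ.1 = m} ≃
      {κ : {κ : V' → ℕ // Proper T' κ} // colorProfile κ.1 = m}) := fun m => by
    have := finite_colorProfile_fiber (T := T) m
    have := finite_colorProfile_fiber (T := T') m
    refine (Finite.card_eq ..).1 ?_
    have := congrFun h m
    rwa [csf_apply, csf_apply, Nat.cast_inj] at this
  refine ⟨(Equiv.sigmaFiberEquiv fun κ : {κ : V → ℕ // Proper T κ} => colorProfile κ.1).symm.trans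
    ((Equiv.sigmaCongrRight fun m => (e m).some).trans
      (Equiv.sigmaFiberEquiv fun κ : {κ : V' → ℕ // Proper T' κ} => colorProfile κ.1)),
    fun κ => ?_⟩
  exact Multiset.toFinsupp.injective ((e (colorProfile κ.1)).some ⟨κ, rfl⟩).2

lemma card_eq_of_csf_eq [Fintype V] [Fintype V'] (h : csf T = csf T') :
    Fintype.card V = Fintype.card V' := by
  obtain ⟨Φ, hΦ⟩ := exists_equiv_of_csf_eq h
  let κ : {κ : V → ℕ // Proper T κ} := ⟨fun v => Fintype.equivFin V v, fun u v huv huv' =>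
    huv.ne ((Fintype.equivFin V).injective (Fin.val_injective huv'))⟩
  simpa using (congrArg Multiset.card (hΦ κ)).symm

lemma forall_lt_and_card_iff [Fintype V] (κ : V → ℕ) (t c k : ℕ) :
    ((∀ v, κ v < t + c) ∧ #{v | t ≤ κ v} = k) ↔
      (∀ x ∈ univ.val.map κ, x < t + c) ∧ (univ.val.map κ).countP (t ≤ ·) = k := by
  simp [Multiset.countP_map, Finset.card]

lemma colorCount_eq_of_csf_eq [Fintype V] [Fintype V'] (h : csf T = csf T') (t c k : ℕ) :
    colorCount T t c k = colorCount T' t c k := by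
  obtain ⟨Φ, hΦ⟩ := exists_equiv_of_csf_eq h
  refine Nat.card_congr (Φ.subtypeEquiv fun κ => ?_)
  rw [forall_lt_and_card_iff, forall_lt_and_card_iff, hΦ]

end ColorCount

section Connected

variable {V V' : Type*} {T' : SimpleGraph V'} {T : SimpleGraph V}

/-- The vertex sets of size `k` that induce a connected subgraph. -/
noncomputable def connectedSets [Fintype V] (T : SimpleGraph V) (k : ℕ) : Finset (Finset V) :=
  {U ∈ powersetCard k univ | (T.induce (U : Set V)).Connected}

lemma mem_connectedSets [Fintype V] (hT : T.IsTree) {k : ℕ} {U : Finset V} :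
    U ∈ connectedSets T k ↔ #U = k ∧ inducedEdges T U + 1 = k := by
  rw [connectedSets, mem_filter, mem_powersetCard_univ, connected_iff_inducedEdges hT]
  exact and_congr_right fun h => by rw [h]

open Polynomial in
lemma coeff_one_forestChrom [Fintype V] (hT : T.IsTree) {k : ℕ} (hk : k ≠ 0) {U : Finset V}
    (hU : #U = k) :
    (forestChrom T U (X : ℤ[X])).coeff 1 =
      if (T.induce (U : Set V)).Connected then (-1) ^ (k - 1) else 0 := by
  have h1 := inducedEdges_lt_card hT (card_pos.1 (by omega : 0 < #U))
  rw [forestChrom]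
  split_ifs with h <;> rw [connected_iff_inducedEdges hT] at h
  · rw [← h, Nat.add_sub_cancel_left, pow_one, ← hU, ← h, Nat.add_sub_cancel,
      coeff_X_mul, coeff_zero_eq_eval_zero]
    simp
  · rw [coeff_X_pow_mul', if_neg (by omega)]

open Polynomial in
lemma sum_forestChrom_compl_eq [Fintype V] [Fintype V'] (hT : T.IsTree) (hT' : T'.IsTree)
    (h : csf T = csf T') {k : ℕ} (hk : k ≠ 0) (t : ℕ) :
    ∑ U ∈ connectedSets T k, forestChrom T Uᶜ (t : ℤ) =
      ∑ U ∈ connectedSets T' k, forestChrom T' Uᶜ (t : ℤ) := by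
  have hp : ∑ U ∈ powersetCard k univ, forestChrom T U (X : ℤ[X]) * C (forestChrom T Uᶜ (t : ℤ)) =
      ∑ U ∈ powersetCard k univ, forestChrom T' U (X : ℤ[X]) * C (forestChrom T' Uᶜ (t : ℤ)) := by
    refine eq_of_infinite_eval_eq _ _ ((Set.infinite_range_of_injective
      (Nat.cast_injective (R := ℤ))).mono ?_)
    rintro _ ⟨c, rfl⟩
    have := congrArg (Nat.cast (R := ℤ)) (colorCount_eq_of_csf_eq h t c k)
    rw [colorCount_eq hT, colorCount_eq hT'] at this
    rw [Set.mem_ofPred_eq, eval_finsetSum, eval_finsetSum]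
    convert this using 2 with U _ U _ <;> simp [forestChrom]
  have hc := congrArg (fun p => p.coeff 1) hp
  simp only [finsetSum_coeff, coeff_mul_C] at hc
  rw [sum_congr rfl fun U hU => by
      rw [coeff_one_forestChrom hT hk (mem_powersetCard_univ.1 hU), ite_mul, zero_mul],
    sum_congr (s₁ := powersetCard k (univ : Finset V')) rfl fun U hU => by
      rw [coeff_one_forestChrom hT' hk (mem_powersetCard_univ.1 hU), ite_mul, zero_mul],
    ← sum_filter, ← sum_filter, ← mul_sum, ← mul_sum] at hc
  exact mul_left_cancel₀ (by simp) hc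

lemma crossCount_compl_add [Fintype V] (hT : T.IsTree) {k : ℕ} {U : Finset V}
    (hU : U ∈ connectedSets T k) :
    crossCount T U Uᶜ + inducedEdges T Uᶜ = Fintype.card V - k := by
  rw [mem_connectedSets hT] at hU
  have h1 := inducedEdges_union (T := T) (disjoint_compl_right (a := U))
  rw [union_compl] at h1
  have h2 : inducedEdges T (univ : Finset V) + 1 = #(univ : Finset V) := by
    rw [← connected_iff_inducedEdges hT, coe_univ]
    exact (SimpleGraph.induceUnivIso T).connected_iff.2 hT.1
  rw [card_univ] at h2
  omega

lemma forestChrom_compl [Fintype V] (hT : T.IsTree) {k : ℕ} {U : Finset V}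
    (hU : U ∈ connectedSets T k) {R : Type*} [CommRing R] (c : R) :
    forestChrom T Uᶜ c =
      c ^ crossCount T U Uᶜ * (c - 1) ^ (Fintype.card V - k - crossCount T U Uᶜ) := by
  have h1 := crossCount_compl_add hT hU
  have h2 := card_compl U
  rw [mem_connectedSets hT] at hU
  rw [forestChrom]
  congr 2 <;> omega

open Polynomial in
lemma sum_one_add_pow_crossCount [Fintype V] (hT : T.IsTree) (k : ℕ) {x : ℚ} (hx : x ≠ 0) :
    ∑ U ∈ connectedSets T k, (1 + x) ^ crossCount T U Uᶜ = x ^ (Fintype.card V - k) *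
      aeval ((1 + x) / x) (∑ U ∈ connectedSets T k, forestChrom T Uᶜ (X : ℤ[X])) := by
  rw [map_sum, mul_sum]
  refine sum_congr rfl fun U hU => ?_
  have h1 : (1 + x) / x - 1 = x⁻¹ := by field_simp; ring
  have h2 : x ^ (Fintype.card V - k) = x ^ crossCount T U Uᶜ *
      x ^ (Fintype.card V - k - crossCount T U Uᶜ) := by
    rw [← pow_add]
    congr 1
    have := crossCount_compl_add hT hU
    omega
  rw [forestChrom_compl hT hU, h2]
  simp only [map_mul, map_pow, map_sub, map_one, aeval_X, h1]
  rw [div_pow, inv_pow]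
  field_simp

open Polynomial in
lemma sum_choose_crossCount_eq [Fintype V] [Fintype V'] (hT : T.IsTree) (hT' : T'.IsTree)
    (h : csf T = csf T') {k : ℕ} (hk : k ≠ 0) (d : ℕ) :
    ∑ U ∈ connectedSets T k, (crossCount T U Uᶜ).choose d =
      ∑ U ∈ connectedSets T' k, (crossCount T' U Uᶜ).choose d := by
  have hp : ∑ U ∈ connectedSets T k, forestChrom T Uᶜ (X : ℤ[X]) =
      ∑ U ∈ connectedSets T' k, forestChrom T' Uᶜ (X : ℤ[X]) := by
    refine eq_of_infinite_eval_eq _ _ ((Set.infinite_range_of_injective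
      (Nat.cast_injective (R := ℤ))).mono ?_)
    rintro _ ⟨t, rfl⟩
    rw [Set.mem_ofPred_eq, eval_finsetSum, eval_finsetSum]
    convert sum_forestChrom_compl_eq hT hT' h hk t using 2 with U _ U _ <;> simp [forestChrom]
  have hq : ∑ U ∈ connectedSets T k, (1 + X : ℚ[X]) ^ crossCount T U Uᶜ =
      ∑ U ∈ connectedSets T' k, (1 + X : ℚ[X]) ^ crossCount T' U Uᶜ := by
    refine eq_of_infinite_eval_eq _ _ ((Set.finite_singleton (0 : ℚ)).infinite_compl.mono ?_)
    intro x hx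
    have h1 := sum_one_add_pow_crossCount hT k (x := x) hx
    rw [hp, card_eq_of_csf_eq h, ← sum_one_add_pow_crossCount hT' k (x := x) hx] at h1
    simpa [eval_finsetSum] using h1
  have hc := congrArg (fun p => p.coeff d) hq
  simp only [finsetSum_coeff, coeff_one_add_X_pow] at hc
  exact_mod_cast hc

end Connected

section Leaves

variable {V V' : Type*} {T' : SimpleGraph V'} {T : SimpleGraph V}

lemma degIn_le_one_of_connected [Fintype V] (hT : T.IsTree) {k : ℕ} {U : Finset V}
    (hU : U ∈ connectedSets T k) {v : V} (hv : v ∉ U) : degIn T v U ≤ 1 := by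
  rw [mem_connectedSets hT] at hU
  have := inducedEdges_lt_card hT (insert_nonempty v U)
  rw [inducedEdges_insert hv, card_insert_of_notMem hv] at this
  omega

lemma crossCount_compl_eq_card [Fintype V] (hT : T.IsTree) {k : ℕ} {U : Finset V}
    (hU : U ∈ connectedSets T k) : crossCount T U Uᶜ = #{v ∈ Uᶜ | degIn T v U = 1} := by
  rw [crossCount_comm, crossCount, card_filter]
  refine sum_congr rfl fun v hv => ?_
  have := degIn_le_one_of_connected hT hU (mem_compl.1 hv)
  split_ifs <;> omega

lemma crossCount_eq_card {U D : Finset V} (h : ∀ v ∈ D, degIn T v U = 1) :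
    crossCount T D U = #D := by
  rw [crossCount, sum_congr rfl h, card_eq_sum_ones]

lemma degIn_self_eq_zero {D : Finset V} (h : inducedEdges T D = 0) {v : V} (hv : v ∈ D) :
    degIn T v D = 0 := by
  have h1 := crossCount_self (T := T) D
  rw [h, mul_zero, crossCount, sum_eq_zero_iff] at h1
  exact h1 v hv

/-- Adding `d` neighbours to a connected set of size `m ≠ 0` is inverse to removing `d` leaves
from a connected set of size `m + d`. -/
lemma sum_choose_crossCount_eq_sum_choose_leafCount [Fintype V] (hT : T.IsTree) {m : ℕ}
    (hm : m ≠ 0) (d : ℕ) :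
    ∑ U ∈ connectedSets T m, (crossCount T U Uᶜ).choose d =
      ∑ S ∈ connectedSets T (m + d), (leafCount T S).choose d := by
  simp only [leafCount_eq]
  rw [sum_congr rfl fun U hU => by rw [crossCount_compl_eq_card hT hU]]
  simp only [← card_powersetCard, ← card_sigma]
  refine card_bij' (fun p _ => ⟨p.1 ∪ p.2, p.2⟩) (fun p _ => ⟨p.1 \ p.2, p.2⟩) ?_ ?_ ?_ ?_
  · rintro ⟨U, D⟩ hp
    rw [mem_sigma, mem_powersetCard, mem_connectedSets hT] at hp
    obtain ⟨⟨hU, he⟩, hD, hd⟩ := hp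
    dsimp only at *
    have hdis : Disjoint U D := disjoint_right.2 fun v hv =>
      mem_compl.1 (mem_filter.1 (hD hv)).1
    have hdeg : ∀ v ∈ D, degIn T v U = 1 := fun v hv => (mem_filter.1 (hD hv)).2
    have h1 := inducedEdges_union (T := T) hdis
    rw [crossCount_comm, crossCount_eq_card hdeg] at h1
    have h2 := card_union_of_disjoint hdis
    have h3 := inducedEdges_lt_card hT (card_pos.1 (by omega : 0 < #(U ∪ D)))
    have h4 : inducedEdges T D = 0 := by omega
    rw [mem_sigma, mem_powersetCard, mem_connectedSets hT]
    refine ⟨by dsimp only; omega, fun v hv => mem_filter.2 ⟨mem_union_right _ hv, ?_⟩, hd⟩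
    rw [degIn_union hdis, hdeg v hv, degIn_self_eq_zero h4 hv]
  · rintro ⟨S, D⟩ hp
    rw [mem_sigma, mem_powersetCard, mem_connectedSets hT] at hp
    obtain ⟨⟨hS, he⟩, hD, hd⟩ := hp
    dsimp only at *
    have hDS : D ⊆ S := hD.trans (filter_subset _ _)
    have hdis : Disjoint (S \ D) D := sdiff_disjoint
    have hun : S \ D ∪ D = S := sdiff_union_of_subset hDS
    have hdeg : ∀ v ∈ D, degIn T v S = 1 := fun v hv => (mem_filter.1 (hD hv)).2
    have h1 := inducedEdges_union (T := T) hdis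
    have h2 := crossCount_union_right (T := T) hdis D
    rw [hun, crossCount_eq_card hdeg, crossCount_self, crossCount_comm] at h2
    have h3 := card_sdiff_add_card_eq_card hDS
    have h4 := inducedEdges_lt_card hT (card_pos.1 (by omega : 0 < #(S \ D)))
    rw [hun] at h1
    have h5 : inducedEdges T D = 0 := by omega
    rw [mem_sigma, mem_powersetCard, mem_connectedSets hT]
    refine ⟨by dsimp only; omega, fun v hv => mem_filter.2 ⟨by simp [hv], ?_⟩, hd⟩
    have h6 := degIn_union (T := T) hdis v
    rw [hun, hdeg v hv, degIn_self_eq_zero h5 hv] at h6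
    exact h6.symm
  · rintro ⟨U, D⟩ hp
    rw [mem_sigma, mem_powersetCard] at hp
    have hdis : Disjoint U D := disjoint_right.2 fun v hv =>
      mem_compl.1 (mem_filter.1 (hp.2.1 hv)).1
    simp [union_sdiff_cancel_right hdis]
  · rintro ⟨S, D⟩ hp
    rw [mem_sigma, mem_powersetCard] at hp
    simp [sdiff_union_of_subset (hp.2.1.trans (filter_subset _ _))]

lemma leafCount_eq_card_iff [Fintype V] (hT : T.IsTree) {s : ℕ} {S : Finset V}
    (hS : S ∈ connectedSets T s) : leafCount T S = s ↔ s = 2 := by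
  rw [mem_connectedSets hT] at hS
  rw [leafCount_eq]
  have h0 := crossCount_self (T := T) S
  constructor
  · intro h
    rw [← hS.1, card_filter_eq_iff] at h
    rw [crossCount_eq_card h] at h0
    omega
  · rintro rfl
    rw [← hS.1, card_filter_eq_iff]
    intro v hv
    have h1 := inducedEdges_insert (T := T) (notMem_erase v S)
    rw [insert_erase hv] at h1
    have h2 := card_erase_of_mem hv
    have h3 := inducedEdges_lt_card hT (card_pos.1 (by omega : 0 < #(S.erase v)))
    have h4 : degIn T v S = degIn T v (S.erase v) := by
      nth_rewrite 1 [← insert_erase hv]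
      rw [degIn, filter_insert, if_neg (T.loopless.irrefl v), degIn]
    omega

lemma leafCount_le [Fintype V] (hT : T.IsTree) {s : ℕ} {S : Finset V}
    (hS : S ∈ connectedSets T s) : leafCount T S ≤ s := by
  rw [leafCount_eq, ← ((mem_connectedSets hT).1 hS).1]
  exact card_filter_le _ _

lemma sum_choose_leafCount_eq [Fintype V] [Fintype V'] (hT : T.IsTree) (hT' : T'.IsTree)
    (h : csf T = csf T') {s : ℕ} (hs : 2 ≤ s) (d : ℕ) :
    ∑ S ∈ connectedSets T s, (leafCount T S).choose d =
      ∑ S ∈ connectedSets T' s, (leafCount T' S).choose d := by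
  have key : ∀ m d : ℕ, m ≠ 0 → ∑ S ∈ connectedSets T (m + d), (leafCount T S).choose d =
      ∑ S ∈ connectedSets T' (m + d), (leafCount T' S).choose d := fun m d hm => by
    rw [← sum_choose_crossCount_eq_sum_choose_leafCount hT hm,
      ← sum_choose_crossCount_eq_sum_choose_leafCount hT' hm,
      sum_choose_crossCount_eq hT hT' h hm]
  rcases hs.eq_or_lt with rfl | hs
  · have h0 := key 2 0 (by omega)
    simp only [add_zero, Nat.choose_zero_right, sum_const, smul_eq_mul, mul_one] at h0
    rw [sum_congr rfl fun S hS => by rw [(leafCount_eq_card_iff hT hS).2 rfl],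
      sum_congr (s₁ := connectedSets T' 2) rfl fun S hS => by
        rw [(leafCount_eq_card_iff hT' hS).2 rfl], sum_const, sum_const, h0]
  · rcases lt_or_ge d s with hd | hd
    · have := key (s - d) d (by omega)
      rwa [Nat.sub_add_cancel hd.le] at this
    · rw [sum_eq_zero fun S hS => Nat.choose_eq_zero_of_lt ?_,
        sum_eq_zero fun S hS => Nat.choose_eq_zero_of_lt ?_]
      · have h1 := leafCount_le hT' hS
        have h2 := leafCount_eq_card_iff hT' hS
        omega
      · have h1 := leafCount_le hT hS
        have h2 := leafCount_eq_card_iff hT hS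
        omega

lemma isSubtree_iff [Fintype V] (hT : T.IsTree) (S : Finset V) :
    IsSubtree T S ↔ (T.induce (S : Set V)).Connected ∧ 2 ≤ #S := by
  refine and_congr_right fun h => ⟨?_, fun h2 => ?_⟩
  · rintro ⟨u, hu, v, hv, huv⟩
    exact one_lt_card.2 ⟨u, hu, v, hv, huv.ne⟩
  · have h1 := inducedEdges_of_connected hT h
    have h3 := crossCount_self (T := T) S
    obtain ⟨u, hu, hne⟩ := exists_ne_zero_of_sum_ne_zero
      (show ∑ u ∈ S, degIn T u S ≠ 0 by rw [← crossCount]; omega)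
    obtain ⟨v, hv⟩ := card_ne_zero.1 hne
    rw [mem_filter] at hv
    exact ⟨u, hu, v, hv.1, hv.2⟩

open MvPolynomial in
lemma subtreePoly_eq [Fintype V] (hT : T.IsTree) :
    subtreePoly T = ∑ s ∈ Icc 2 (Fintype.card V), X 0 ^ (s - 1) *
      ∑ d ∈ range (Fintype.card V + 1),
        (X 1 - 1) ^ d * ((∑ S ∈ connectedSets T s, (leafCount T S).choose d : ℕ) :
          MvPolynomial (Fin 2) ℤ) := by
  rw [subtreePoly, ← sum_fiberwise_of_maps_to (g := card) (t := Icc 2 (Fintype.card V))]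
  · refine sum_congr rfl fun s hs => ?_
    have h1 : {A ∈ {A ∈ (univ : Finset V).powerset | IsSubtree T A} | #A = s} =
        connectedSets T s := by
      ext A
      have := (mem_Icc.1 hs).1
      simp only [mem_filter, mem_powerset, subset_univ, true_and, isSubtree_iff hT, connectedSets,
        mem_powersetCard_univ]
      constructor
      · tauto
      · rintro ⟨rfl, h⟩
        exact ⟨⟨h, this⟩, rfl⟩
    rw [h1]
    simp only [Nat.cast_sum, mul_sum]
    rw [sum_comm]
    refine sum_congr rfl fun S hS => ?_
    have h2 : leafCount T S < Fintype.card V + 1 :=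
      Nat.lt_succ_of_le ((leafCount_le hT hS).trans (mem_Icc.1 hs).2)
    rw [mem_connectedSets hT] at hS
    rw [edgeCount_eq, ← mul_sum, show inducedEdges T S = s - 1 by omega]
    congr 1
    nth_rewrite 1 [← sub_add_cancel (X 1 : MvPolynomial (Fin 2) ℤ) 1]
    rw [add_pow]
    refine sum_subset_zero_on_sdiff (range_mono h2) (fun d hd => ?_) fun d _ => by simp
    rw [mem_sdiff, mem_range, mem_range] at hd
    rw [Nat.choose_eq_zero_of_lt (by omega), Nat.cast_zero, mul_zero]
  · intro A hA
    rw [mem_filter, isSubtree_iff hT] at hA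
    exact mem_Icc.2 ⟨hA.2.2, card_le_univ A⟩

end Leaves

theorem stmt0 {V V' : Type*} [Fintype V] [Fintype V']
    (T : SimpleGraph V) (T' : SimpleGraph V') (hT : T.IsTree) (hT' : T'.IsTree)
    (h : csf T = csf T') :
    subtreePoly T = subtreePoly T' := by
  rw [subtreePoly_eq hT, subtreePoly_eq hT', card_eq_of_csf_eq h]
  refine sum_congr rfl fun s hs => ?_
  simp only [sum_choose_leafCount_eq hT hT' h (mem_Icc.1 hs).1]
end

section
/- Let T and T' be finite trees. If their bivariate subtree polynomials are equal, i.e. S_T(q,r) = S_{T'}(q,r), then T and T' have the same degree sequence, i.e. the multiset of vertex degrees of T equals that of T'. -/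
open scoped Classical

section

variable {V : Type*}

/-- In a tree all of whose vertices but one are leaves, the remaining vertex is universal. -/
theorem SimpleGraph.IsTree.exists_isUniversal [Fintype V] {G : SimpleGraph V}
    [DecidableRel G.Adj] (hG : G.IsTree)
    (h : (Finset.univ.filter fun v => G.degree v = 1).card + 1 = Fintype.card V) :
    ∃ c, G.IsUniversal c := by
  have hcompl : (Finset.univ.filter fun v => ¬ G.degree v = 1).card = 1 := by
    have := Finset.card_filter_add_card_filter_not (s := Finset.univ) (fun v => G.degree v = 1)
    rw [Finset.card_univ] at this
    omega
  obtain ⟨c, hc⟩ := Finset.card_eq_one.mp hcompl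
  refine ⟨c, (G.degree_eq_card_sub_one c).mp ?_⟩
  have hsum := G.sum_degrees_eq_twice_card_edges
  rw [← Finset.sum_filter_add_sum_filter_not _ (fun v => G.degree v = 1), hc,
    Finset.sum_singleton, Finset.sum_congr rfl (g := fun _ => 1) (by simp), Finset.sum_const,
    smul_eq_mul, mul_one] at hsum
  have hcard := hG.card_edgeFinset
  omega

/-- A tree on at least three vertices with a universal vertex is a star. -/
theorem SimpleGraph.IsTree.degree_eq_one_iff_of_isUniversal [Fintype V] {G : SimpleGraph V}
    [DecidableRel G.Adj] (hG : G.IsTree) (hcard : 3 ≤ Fintype.card V) {c : V} (hc : G.IsUniversal c) (v : V) :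
    G.degree v = 1 ↔ v ≠ c := by
  have hdeg := (G.degree_eq_card_sub_one c).mpr hc
  constructor
  · rintro hv rfl
    omega
  · intro hv
    have : Nontrivial V := Fintype.one_lt_card_iff_nontrivial.mp (by omega)
    have hpos : ∀ w ∈ Finset.univ.erase c, 1 ≤ G.degree w := fun w _ =>
      hG.connected.preconnected.degree_pos_of_nontrivial w
    have hsum := G.sum_degrees_eq_twice_card_edges
    rw [← Finset.add_sum_erase _ _ (Finset.mem_univ c)] at hsum
    have hedges := hG.card_edgeFinset
    refine ((Finset.sum_eq_sum_iff_of_le hpos).mp ?_ v (by simp [hv])).symm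
    rw [Finset.sum_const, Finset.card_erase_of_mem (Finset.mem_univ c), Finset.card_univ,
      smul_eq_mul, mul_one]
    omega

theorem SimpleGraph.IsTree.isTree_induce {T : SimpleGraph V} (hT : T.IsTree) {A : Set V}
    (hA : (T.induce A).Connected) : (T.induce A).IsTree :=
  ⟨hA, hT.isAcyclic.induce A⟩

theorem edgeCount_add_one [Fintype V] {T : SimpleGraph V} (hT : T.IsTree) {A : Finset V}
    (hA : IsSubtree T A) : edgeCount T A + 1 = A.card := by
  have := (SimpleGraph.isTree_iff_connected_and_card.mp (hT.isTree_induce hA.1)).2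
  simpa [edgeCount] using this

theorem leafCount_eq_card [Fintype V] (T : SimpleGraph V) (A : Finset V) :
    leafCount T A =
      (Finset.univ.filter fun v => (T.induce (A : Set V)).degree v = 1).card := by
  rw [leafCount, Nat.card_eq_fintype_card, Fintype.card_subtype]
  congr! 3 with v
  rw [Nat.card_eq_fintype_card, SimpleGraph.card_neighborSet_eq_degree]

/-- The subtrees whose edges are as numerous as their leaves are exactly the stars. -/
theorem isSubtree_and_counts_iff [Fintype V] {T : SimpleGraph V} (hT : T.IsTree) {k : ℕ}
    (hk : 2 ≤ k) (A : Finset V) :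
    (IsSubtree T A ∧ edgeCount T A = k ∧ leafCount T A = k) ↔
      ∃ c, ∃ S ⊆ T.neighborFinset c, S.card = k ∧ insert c S = A := by
  constructor
  · rintro ⟨hA, he, hl⟩
    have hcard := edgeCount_add_one hT hA
    rw [leafCount_eq_card] at hl
    obtain ⟨⟨c, hcA⟩, hc⟩ := (hT.isTree_induce hA.1).exists_isUniversal
      (by rw [hl, ← he, hcard]; simp)
    rw [Finset.mem_coe] at hcA
    refine ⟨c, A.erase c, fun v hv => ?_, ?_, Finset.insert_erase hcA⟩
    · rw [Finset.mem_erase] at hv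
      have := @hc ⟨v, hv.2⟩ (fun h => hv.1 (congrArg Subtype.val h).symm)
      simpa using this
    · rw [Finset.card_erase_of_mem hcA]
      omega
  · rintro ⟨c, S, hS, hSk, rfl⟩
    have hcS : c ∉ S := fun h => by simpa using hS h
    set A := insert c S
    have hcA : c ∈ A := Finset.mem_insert_self c S
    have hAk : A.card = k + 1 := by rw [Finset.card_insert_of_notMem hcS, hSk]
    have huniv : (T.induce (A : Set V)).IsUniversal ⟨c, hcA⟩ := by
      rintro ⟨w, hw⟩ hne
      rcases Finset.mem_insert.mp hw with rfl | hw
      · exact absurd rfl hne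
      · simpa using hS hw
    have hconn := SimpleGraph.Connected.of_isUniversal huniv
    obtain ⟨w, hw⟩ := Finset.card_pos.mp (by omega : 0 < S.card)
    have hA : IsSubtree T A :=
      ⟨hconn, c, hcA, w, Finset.mem_insert_of_mem hw, by simpa using hS hw⟩
    have he := edgeCount_add_one hT hA
    refine ⟨hA, by omega, ?_⟩
    have hcardA : Fintype.card (A : Set V) = k + 1 := by simpa using hAk
    rw [leafCount_eq_card]
    simp only [(hT.isTree_induce hconn).degree_eq_one_iff_of_isUniversal (by omega) huniv]
    rw [Finset.filter_ne', Finset.card_erase_of_mem (Finset.mem_univ _), Finset.card_univ, hcardA]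
    rfl

theorem insert_injective_of_subset_neighborFinset [Fintype V] {T : SimpleGraph V} (hT : T.IsTree)
    {c d : V} {S R : Finset V} (hS : S ⊆ T.neighborFinset c) (hR : R ⊆ T.neighborFinset d)
    (hcard : 2 ≤ S.card) (h : insert c S = insert d R) : c = d ∧ S = R := by
  have hcS : c ∉ S := fun h => by simpa using hS h
  have hdR : d ∉ R := fun h => by simpa using hR h
  have hcd : c = d := by
    have hcA : c ∈ insert c S := Finset.mem_insert_self c S
    have hdA : d ∈ insert c S := h ▸ Finset.mem_insert_self d R
    have hc : (T.induce ((insert c S : Finset V) : Set V)).IsUniversal ⟨c, hcA⟩ := by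
      rintro ⟨w, hw⟩ hne
      rcases Finset.mem_insert.mp hw with rfl | hw
      · exact absurd rfl hne
      · simpa using hS hw
    have hd : (T.induce ((insert c S : Finset V) : Set V)).IsUniversal ⟨d, hdA⟩ := by
      rintro ⟨w, hw⟩ hne
      rw [Finset.mem_coe, h] at hw
      rcases Finset.mem_insert.mp hw with rfl | hw
      · exact absurd rfl hne
      · simpa using hR hw
    have htree := hT.isTree_induce (SimpleGraph.Connected.of_isUniversal hc)
    have h3 : 3 ≤ Fintype.card ((insert c S : Finset V) : Set V) := by
      have := Finset.card_insert_of_notMem hcS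
      simp only [Finset.coe_sort_coe, Fintype.card_coe]
      omega
    by_contra hne
    have hleaf := (htree.degree_eq_one_iff_of_isUniversal h3 hc ⟨d, hdA⟩).mpr
      (fun h => hne (congrArg Subtype.val h).symm)
    exact (htree.degree_eq_one_iff_of_isUniversal h3 hd ⟨d, hdA⟩).mp hleaf rfl
  subst hcd
  exact ⟨rfl, by rw [← Finset.erase_insert hcS, h, Finset.erase_insert hdR]⟩

theorem coeff_subtreePoly [Fintype V] (T : SimpleGraph V) (e l : ℕ) :
    (subtreePoly T).coeff (Finsupp.single 0 e + Finsupp.single 1 l) =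
      ((Finset.univ.filter fun A : Finset V =>
        IsSubtree T A ∧ edgeCount T A = e ∧ leafCount T A = l).card : ℤ) := by
  have hinj : ∀ a b : ℕ, (Finsupp.single (0 : Fin 2) a + Finsupp.single 1 b =
      Finsupp.single 0 e + Finsupp.single 1 l) ↔ a = e ∧ b = l := by
    intro a b
    simp [Finsupp.ext_iff, Fin.forall_fin_two]
  simp only [subtreePoly, MvPolynomial.coeff_sum, MvPolynomial.X_pow_eq_monomial,
    MvPolynomial.monomial_mul, mul_one, MvPolynomial.coeff_monomial, hinj]
  rw [Finset.sum_boole, Finset.powerset_univ, Finset.filter_filter]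

/-- The number of stars with `k ≥ 2` edges, counted by their centers. -/
theorem sum_choose_degree [Fintype V] {T : SimpleGraph V} (hT : T.IsTree) {k : ℕ} (hk : 2 ≤ k) :
    ∑ v, (T.degree v).choose k = (Finset.univ.filter fun A : Finset V =>
      IsSubtree T A ∧ edgeCount T A = k ∧ leafCount T A = k).card := by
  simp only [isSubtree_and_counts_iff hT hk, ← SimpleGraph.card_neighborFinset_eq_degree,
    ← Finset.card_powersetCard, ← Finset.card_sigma]
  refine Finset.card_bij (fun x _ => insert x.1 x.2) ?_ ?_ ?_
  · rintro ⟨c, S⟩ h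
    simp only [Finset.mem_sigma, Finset.mem_univ, true_and, Finset.mem_powersetCard] at h
    exact Finset.mem_filter.mpr ⟨Finset.mem_univ _, c, S, h.1, h.2, rfl⟩
  · rintro ⟨c, S⟩ hS ⟨d, R⟩ hR h
    simp only [Finset.mem_sigma, Finset.mem_univ, true_and, Finset.mem_powersetCard] at hS hR
    obtain ⟨rfl, rfl⟩ :=
      insert_injective_of_subset_neighborFinset hT hS.1 hR.1 (hS.2.symm ▸ hk) h
    rfl
  · intro A hA
    obtain ⟨c, S, hS, hSk, h⟩ := (Finset.mem_filter.mp hA).2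
    refine ⟨⟨c, S⟩, ?_, h⟩
    simpa [Finset.mem_powersetCard] using ⟨hS, hSk⟩

theorem card_le_of_subtreePoly_eq {V' : Type*} [Fintype V] [Fintype V'] {T : SimpleGraph V}
    {T' : SimpleGraph V'} (hT : T.IsTree) (hT' : T'.IsTree)
    (h : subtreePoly T = subtreePoly T') : Fintype.card V ≤ Fintype.card V' := by
  have := hT'.connected.nonempty
  rcases subsingleton_or_nontrivial V with hV | hV
  · exact (Fintype.card_le_one_iff_subsingleton.mpr hV).trans Fintype.card_pos
  obtain ⟨u⟩ := hT.connected.nonempty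
  obtain ⟨v, huv⟩ := hT.connected.preconnected.exists_adj_of_nontrivial u
  have huniv : IsSubtree T Finset.univ := by
    refine ⟨?_, u, Finset.mem_univ u, v, Finset.mem_univ v, huv⟩
    rw [Finset.coe_univ]
    exact (SimpleGraph.induceUnivIso T).connected_iff.mpr hT.connected
  have hcoeff := congrArg (MvPolynomial.coeff (Finsupp.single 0 (edgeCount T Finset.univ) +
    Finsupp.single 1 (leafCount T Finset.univ))) h
  rw [coeff_subtreePoly, coeff_subtreePoly, Nat.cast_inj] at hcoeff
  obtain ⟨A, hA⟩ := Finset.card_pos.mp (hcoeff ▸ Finset.card_pos.mpr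
    ⟨Finset.univ, by simpa using huniv⟩)
  obtain ⟨-, hsub, he, -⟩ := Finset.mem_filter.mp hA
  rw [← Finset.card_univ, ← edgeCount_add_one hT huniv, ← he, edgeCount_add_one hT' hsub]
  exact Finset.card_le_univ A

/-- A finite multiset of natural numbers is determined by its binomial moments. -/
theorem Multiset.eq_of_sum_choose_eq {s t : Multiset ℕ}
    (h : ∀ k, (s.map fun d => d.choose k).sum = (t.map fun d => d.choose k).sum) : s = t := by
  have hcoeff : ∀ (u : Multiset ℕ) (k : ℕ),
      (u.map fun d => ((Polynomial.X + 1 : Polynomial ℤ) ^ d)).sum.coeff k =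
        (((u.map fun d => d.choose k).sum : ℕ) : ℤ) := by
    intro u k
    induction u using Multiset.induction_on with
    | empty => simp
    | cons a u ih => simp [ih, Polynomial.coeff_X_add_one_pow]
  have hcomp : ∀ u : Multiset ℕ,
      (u.map fun d => ((Polynomial.X + 1 : Polynomial ℤ) ^ d)).sum.comp (Polynomial.X - 1) =
        (u.map fun d => (Polynomial.X : Polynomial ℤ) ^ d).sum := by
    intro u
    induction u using Multiset.induction_on with
    | empty => simp
    | cons a u ih => simp [ih]
  have hcount : ∀ (u : Multiset ℕ) (d : ℕ),
      (u.map fun d => (Polynomial.X : Polynomial ℤ) ^ d).sum.coeff d = (u.count d : ℤ) := by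
    intro u d
    induction u using Multiset.induction_on with
    | empty => simp
    | cons a u ih =>
      simp only [Multiset.map_cons, Multiset.sum_cons, Polynomial.coeff_add, ih,
        Polynomial.coeff_X_pow, Multiset.count_cons]
      push_cast
      ring
  have hpoly : (s.map fun d => ((Polynomial.X + 1 : Polynomial ℤ) ^ d)).sum =
      (t.map fun d => ((Polynomial.X + 1 : Polynomial ℤ) ^ d)).sum := by
    ext k
    rw [hcoeff, hcoeff, h]
  ext d
  have := congrArg (fun p => (p.comp (Polynomial.X - 1)).coeff d) hpoly
  simp only [hcomp, hcount] at this
  exact_mod_cast this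

end

theorem stmt1 {V V' : Type*} [Fintype V] [Fintype V']
    (T : SimpleGraph V) (T' : SimpleGraph V') (hT : T.IsTree) (hT' : T'.IsTree)
    (h : subtreePoly T = subtreePoly T') :
    degreeSequence T = degreeSequence T' := by
  have hcard : Fintype.card V = Fintype.card V' :=
    (card_le_of_subtreePoly_eq hT hT' h).antisymm (card_le_of_subtreePoly_eq hT' hT h.symm)
  have hsum : ∑ v, T.degree v = ∑ v, T'.degree v := by
    have h₁ := hT.card_edgeFinset
    have h₂ := hT'.card_edgeFinset
    rw [T.sum_degrees_eq_twice_card_edges, T'.sum_degrees_eq_twice_card_edges]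
    omega
  refine Multiset.eq_of_sum_choose_eq fun k => ?_
  simp only [degreeSequence, Multiset.map_map, Function.comp_def]
  change ∑ v, (T.degree v).choose k = ∑ v, (T'.degree v).choose k
  match k with
  | 0 => simpa using hcard
  | 1 => simpa using hsum
  | k + 2 =>
    rw [sum_choose_degree hT (by omega), sum_choose_degree hT' (by omega),
      ← Nat.cast_inj (R := ℤ), ← coeff_subtreePoly, ← coeff_subtreePoly, h]
end
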